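/- (Fluid limit convergence for GRAND(aZ), Lemma 4 core.) Every differentiable function x : [0,∞) → X satisfying x'(t) = F(x(t)) for all t ≥ 0 converges to x^{*,a} as t → ∞, and the convergence is uniform over all such solutions: for every ε > 0 there exists T > 0 (independent of the solution) such that ‖x(t) − x^{*,a}‖ ≤ ε for all t ≥ T. -/

import Mathlib

open scoped BigOperators
open Filter Topology

noncomputable section

variable {I S : Type} [Fintype I] [DecidableEq I] [Fintype S]

/-- The configuration `e_i` consisting of a single type-`i` customer. -/
def econf (i : I) : I → ℕ := Pi.single i 1

/-- `K^s`: the set of nonzero configurations of server type `s`. -/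
def Kc (Kbar : S → Finset (I → ℕ)) (s : S) : Finset (I → ℕ) := (Kbar s).erase 0

/-- Monotonicity of the configuration sets. -/
def KbarMono (Kbar : S → Finset (I → ℕ)) : Prop :=
  ∀ s, ∀ k ∈ Kbar s, ∀ k' : I → ℕ, (∀ i, k' i ≤ k i) → k' ∈ Kbar s

/-- Each configuration set contains the zero configuration. -/
def KbarZero (Kbar : S → Finset (I → ℕ)) : Prop := ∀ s, (0 : I → ℕ) ∈ Kbar s

/-- Every customer type can be served by some server type. -/
def KbarServe (Kbar : S → Finset (I → ℕ)) : Prop := ∀ i : I, ∃ s, econf i ∈ Kbar s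

/-- `ℝ_+^K`: nonnegative vectors supported on the nonzero configurations. -/
def orthK (Kbar : S → Finset (I → ℕ)) : Set (S → (I → ℕ) → ℝ) :=
  {x | (∀ s k, 0 ≤ x s k) ∧ ∀ s, ∀ k, k ∉ Kc Kbar s → x s k = 0}

/-- The feasible set `X` (equality constraints). -/
def feasX (Kbar : S → Finset (I → ℕ)) (ρ : I → ℝ) : Set (S → (I → ℕ) → ℝ) :=
  {x | x ∈ orthK Kbar ∧ ∀ i, ∑ s, ∑ k ∈ Kc Kbar s, (k i : ℝ) * x s k = ρ i}

/-- The relaxed feasible set (inequality constraints). -/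
def feasXge (Kbar : S → Finset (I → ℕ)) (ρ : I → ℝ) : Set (S → (I → ℕ) → ℝ) :=
  {x | x ∈ orthK Kbar ∧ ∀ i, ρ i ≤ ∑ s, ∑ k ∈ Kc Kbar s, (k i : ℝ) * x s k}

/-- The weighted number of occupied servers. -/
def objW (Kbar : S → Finset (I → ℕ)) (γ : S → ℝ) (x : S → (I → ℕ) → ℝ) : ℝ :=
  ∑ s, ∑ k ∈ Kc Kbar s, γ s * x s k

/-- `X*`: optimal solutions of LP=. -/
def XstarSet (Kbar : S → Finset (I → ℕ)) (ρ : I → ℝ) (γ : S → ℝ) :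
    Set (S → (I → ℕ) → ℝ) :=
  {x | x ∈ feasX Kbar ρ ∧ ∀ y ∈ feasX Kbar ρ, objW Kbar γ x ≤ objW Kbar γ y}

/-- `X**`: optimal solutions of LP≤. -/
def XstarSetGe (Kbar : S → Finset (I → ℕ)) (ρ : I → ℝ) (γ : S → ℝ) :
    Set (S → (I → ℕ) → ℝ) :=
  {x | x ∈ feasXge Kbar ρ ∧ ∀ y ∈ feasXge Kbar ρ, objW Kbar γ x ≤ objW Kbar γ y}

/-- `H*`: dual optimal vectors. -/
def HstarSet (Kbar : S → Finset (I → ℕ)) (ρ : I → ℝ) (γ : S → ℝ) : Set (I → ℝ) :=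
  {η | ∃ x ∈ feasX Kbar ρ, (∀ i, 0 ≤ η i) ∧
    (∀ s, ∀ k ∈ Kc Kbar s, ∑ i, (k i : ℝ) * η i ≤ γ s) ∧
    (∀ s, ∀ k ∈ Kc Kbar s, (∑ i, (k i : ℝ) * η i) < γ s → x s k = 0)}

/-- `c_k = ∏_i k_i!`. -/
def ck (k : I → ℕ) : ℝ := ∏ i, (Nat.factorial (k i) : ℝ)

/-- The function `L^{(a)}`. -/
def Lfun (Kbar : S → Finset (I → ℕ)) (a : S → ℝ) (x : S → (I → ℕ) → ℝ) : ℝ :=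
  ∑ s, ∑ k ∈ Kc Kbar s, x s k * Real.log (x s k * ck k / (Real.exp 1 * a s))

/-- Product form (infinite-server system). -/
def prodForm (Kbar : S → Finset (I → ℕ)) (a : S → ℝ) (x : S → (I → ℕ) → ℝ)
    (ν : I → ℝ) : Prop :=
  ∀ s, ∀ k ∈ Kc Kbar s, x s k = a s / ck k * Real.exp (∑ i, (k i : ℝ) * ν i)

/-- ℓ¹ distance on the coordinates indexed by `K`. -/
def distK (Kbar : S → Finset (I → ℕ)) (x y : S → (I → ℕ) → ℝ) : ℝ :=
  ∑ s, ∑ k ∈ Kc Kbar s, |x s k - y s k|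

/-- Extended coordinate value: the zero configuration of type `s` has value `a_s`. -/
def xval (a : S → ℝ) (x : S → (I → ℕ) → ℝ) (s : S) (k : I → ℕ) : ℝ :=
  if k = 0 then a s else x s k

/-- `x_{(i)}`: amount of servers available to a type-`i` arrival (GRAND(aZ)). -/
def xavail (Kbar : S → Finset (I → ℕ)) (a : S → ℝ) (x : S → (I → ℕ) → ℝ) (i : I) : ℝ :=
  ∑ s, ((if econf i ∈ Kc Kbar s then a s else 0)
    + ∑ k ∈ (Kc Kbar s).filter (fun k => k + econf i ∈ Kbar s), x s k)

/-- Departure rate `w_{k i}`. -/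
def wrate (μ : I → ℝ) (x : S → (I → ℕ) → ℝ) (s : S) (k : I → ℕ) (i : I) : ℝ :=
  (k i : ℝ) * μ i * x s k

/-- Arrival rate `v_{k i}` (GRAND(aZ)), with `λ_i = μ_i ρ_i`. -/
def vrate (Kbar : S → Finset (I → ℕ)) (a : S → ℝ) (μ ρ : I → ℝ)
    (x : S → (I → ℕ) → ℝ) (s : S) (k : I → ℕ) (i : I) : ℝ :=
  μ i * ρ i * xval a x s (k - econf i) / xavail Kbar a x i

/-- The GRAND(aZ) fluid vector field `F_k(x)`, for `k ∈ K^s`. -/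
def Fdrift (Kbar : S → Finset (I → ℕ)) (a : S → ℝ) (μ ρ : I → ℝ)
    (x : S → (I → ℕ) → ℝ) (s : S) (k : I → ℕ) : ℝ :=
  (∑ i ∈ Finset.univ.filter (fun i : I => 1 ≤ k i ∧ k - econf i ∈ Kbar s),
    (vrate Kbar a μ ρ x s k i - wrate μ x s k i))
  - ∑ i ∈ Finset.univ.filter (fun i : I => k + econf i ∈ Kbar s),
    (vrate Kbar a μ ρ x s (k + econf i) i - wrate μ x s (k + econf i) i)

/-- The function `Ξ(x)` (GRAND(aZ)). -/
def Xi (Kbar : S → Finset (I → ℕ)) (a : S → ℝ) (μ : I → ℝ)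
    (x : S → (I → ℕ) → ℝ) : ℝ :=
  ∑ i : I, ∑ s : S,
    ∑ k ∈ (Kc Kbar s).filter (fun k => 1 ≤ k i ∧ k - econf i ∈ Kbar s),
      ∑ s' : S,
        ∑ k' ∈ (Kc Kbar s').filter (fun k' => 1 ≤ k' i ∧ k' - econf i ∈ Kbar s'),
          (Real.log ((k' i : ℝ) * xval a x s (k - econf i) * x s' k')
            - Real.log ((k i : ℝ) * x s k * xval a x s' (k' - econf i)))
          * ((k i : ℝ) * μ i * x s k * xval a x s' (k' - econf i) / xavail Kbar a x i)

open Classical in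
/-- `Ξ` extended by `−∞` to points with a vanishing coordinate, as a map into `[−∞, 0] ⊆ EReal`. -/
def XiE (Kbar : S → Finset (I → ℕ)) (a : S → ℝ) (μ : I → ℝ)
    (x : S → (I → ℕ) → ℝ) : EReal :=
  if ∀ s, ∀ k ∈ Kc Kbar s, 0 < x s k then ((Xi Kbar a μ x : ℝ) : EReal) else ⊥

/-! Finite-server (GRAND-F) objects. -/

/-- `X^□`. -/
def XBox (Kbar : S → Finset (I → ℕ)) (h : S → ℝ) : Set (S → (I → ℕ) → ℝ) :=
  {x | x ∈ orthK Kbar ∧ ∀ s, ∑ k ∈ Kc Kbar s, x s k ≤ h s}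

/-- `x_{0^s} = h_s − Σ_{k∈K^s} x_k`. -/
def x0 (Kbar : S → Finset (I → ℕ)) (h : S → ℝ) (x : S → (I → ℕ) → ℝ) (s : S) : ℝ :=
  h s - ∑ k ∈ Kc Kbar s, x s k

/-- `X^⋄ = X^□ ∩ X`. -/
def XDiamond (Kbar : S → Finset (I → ℕ)) (h : S → ℝ) (ρ : I → ℝ) :
    Set (S → (I → ℕ) → ℝ) := XBox Kbar h ∩ feasX Kbar ρ

/-- Assumption A: a feasible point with idle servers of every type. -/
def AssumptionA (Kbar : S → Finset (I → ℕ)) (h : S → ℝ) (ρ : I → ℝ) : Prop :=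
  ∃ x ∈ XDiamond Kbar h ρ, ∀ s, 0 < x0 Kbar h x s

/-- The function `L^□`. -/
def LBox (Kbar : S → Finset (I → ℕ)) (h : S → ℝ) (x : S → (I → ℕ) → ℝ) : ℝ :=
  ∑ s, (x0 Kbar h x s * Real.log (x0 Kbar h x s / Real.exp 1)
    + ∑ k ∈ Kc Kbar s, x s k * Real.log (x s k * ck k / Real.exp 1))

/-- Product form (finite-server system), including the zero configurations. -/
def prodFormBox (Kbar : S → Finset (I → ℕ)) (h : S → ℝ) (x : S → (I → ℕ) → ℝ)
    (ν : I → ℝ) (β : S → ℝ) : Prop :=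
  ∀ s, x0 Kbar h x s = Real.exp (-β s) ∧
    ∀ k ∈ Kc Kbar s, x s k = Real.exp (-β s) / ck k * Real.exp (∑ i, (k i : ℝ) * ν i)

/-- Extended coordinate value for the finite-server system. -/
def xvalBox (Kbar : S → Finset (I → ℕ)) (h : S → ℝ) (x : S → (I → ℕ) → ℝ)
    (s : S) (k : I → ℕ) : ℝ :=
  if k = 0 then x0 Kbar h x s else x s k

/-- `x_{(i)}` for the finite-server system (zero configurations included). -/
def xavailBox (Kbar : S → Finset (I → ℕ)) (h : S → ℝ) (x : S → (I → ℕ) → ℝ)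
    (i : I) : ℝ :=
  ∑ s, ((if econf i ∈ Kc Kbar s then x0 Kbar h x s else 0)
    + ∑ k ∈ (Kc Kbar s).filter (fun k => k + econf i ∈ Kbar s), x s k)

/-- Arrival rate `v_{k i}` (GRAND-F), with `λ_i = μ_i ρ_i`. -/
def vrateBox (Kbar : S → Finset (I → ℕ)) (h : S → ℝ) (μ ρ : I → ℝ)
    (x : S → (I → ℕ) → ℝ) (s : S) (k : I → ℕ) (i : I) : ℝ :=
  μ i * ρ i * xvalBox Kbar h x s (k - econf i) / xavailBox Kbar h x i

/-- The GRAND-F fluid vector field `F^□_k(x)`, for `k ∈ K^s`. -/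
def FdriftBox (Kbar : S → Finset (I → ℕ)) (h : S → ℝ) (μ ρ : I → ℝ)
    (x : S → (I → ℕ) → ℝ) (s : S) (k : I → ℕ) : ℝ :=
  (∑ i ∈ Finset.univ.filter (fun i : I => 1 ≤ k i ∧ k - econf i ∈ Kbar s),
    (vrateBox Kbar h μ ρ x s k i - wrate μ x s k i))
  - ∑ i ∈ Finset.univ.filter (fun i : I => k + econf i ∈ Kbar s),
    (vrateBox Kbar h μ ρ x s (k + econf i) i - wrate μ x s (k + econf i) i)

/-- The function `Ξ^□(x̄)`. -/
def XiBox (Kbar : S → Finset (I → ℕ)) (h : S → ℝ) (μ : I → ℝ)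
    (x : S → (I → ℕ) → ℝ) : ℝ :=
  ∑ i : I, ∑ s : S,
    ∑ k ∈ (Kc Kbar s).filter (fun k => 1 ≤ k i ∧ k - econf i ∈ Kbar s),
      ∑ s' : S,
        ∑ k' ∈ (Kc Kbar s').filter (fun k' => 1 ≤ k' i ∧ k' - econf i ∈ Kbar s'),
          (Real.log ((k' i : ℝ) * xvalBox Kbar h x s (k - econf i) * x s' k')
            - Real.log ((k i : ℝ) * x s k * xvalBox Kbar h x s' (k' - econf i)))
          * ((k i : ℝ) * μ i * x s k * xvalBox Kbar h x s' (k' - econf i)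
              / xavailBox Kbar h x i)

set_option linter.unusedSectionVars false

lemma econf_le {i : I} {k : I → ℕ} (hk : 1 ≤ k i) : econf i ≤ k := by
  intro j
  rcases eq_or_ne j i with rfl | h
  · simpa [econf] using hk
  · simp [econf, h]

lemma sub_econf_mem {Kbar : S → Finset (I → ℕ)} (hmono : KbarMono Kbar) {s : S} {k : I → ℕ}
    (hk : k ∈ Kbar s) (i : I) : k - econf i ∈ Kbar s :=
  hmono s k hk _ fun j => by simp

lemma ne_zero_of_one_le {i : I} {k : I → ℕ} (hk : 1 ≤ k i) : k ≠ 0 := by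
  rintro rfl
  simp at hk

lemma mem_Kc {Kbar : S → Finset (I → ℕ)} {s : S} {k : I → ℕ} :
    k ∈ Kc Kbar s ↔ k ≠ 0 ∧ k ∈ Kbar s := by
  simp [Kc]

lemma exists_one_le {k : I → ℕ} (hk : k ≠ 0) : ∃ i, 1 ≤ k i := by
  by_contra! h
  exact hk (funext fun i => by simpa using h i)

/-- The configurations of server type `s` containing a type-`i` customer. -/
def occupied (Kbar : S → Finset (I → ℕ)) (s : S) (i : I) : Finset (I → ℕ) :=
  (Kbar s).filter fun k => 1 ≤ k i

lemma mem_occupied {Kbar : S → Finset (I → ℕ)} {s : S} {i : I} {k : I → ℕ} :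
    k ∈ occupied Kbar s i ↔ k ∈ Kbar s ∧ 1 ≤ k i := by
  simp [occupied]

lemma mem_Kc_of_mem_occupied {Kbar : S → Finset (I → ℕ)} {s : S} {i : I} {k : I → ℕ}
    (hk : k ∈ occupied Kbar s i) : k ∈ Kc Kbar s :=
  mem_Kc.2 ⟨ne_zero_of_one_le (mem_occupied.1 hk).2, (mem_occupied.1 hk).1⟩

lemma sum_shift {Kbar : S → Finset (I → ℕ)} (hmono : KbarMono Kbar) (s : S) (i : I)
    (f : (I → ℕ) → ℝ) :
    ∑ k ∈ (Kbar s).filter (fun k => k + econf i ∈ Kbar s), f k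
      = ∑ k ∈ occupied Kbar s i, f (k - econf i) := by
  refine Finset.sum_nbij' (fun k => k + econf i) (fun k => k - econf i) ?_ ?_ ?_ ?_ ?_
  · intro k hk
    simp only [Finset.mem_filter] at hk
    exact mem_occupied.2 ⟨hk.2, by simp [econf]⟩
  · intro k hk
    obtain ⟨h1, h2⟩ := mem_occupied.1 hk
    simp only [Finset.mem_filter]
    exact ⟨sub_econf_mem hmono h1 i, by rwa [tsub_add_cancel_of_le (econf_le h2)]⟩
  · intro k _
    exact add_tsub_cancel_right k _
  · intro k hk
    exact tsub_add_cancel_of_le (econf_le (mem_occupied.1 hk).2)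
  · intro k _
    simp

lemma xval_zero (a : S → ℝ) (x : S → (I → ℕ) → ℝ) (s : S) : xval a x s 0 = a s := by
  simp [xval]

lemma xval_of_ne (a : S → ℝ) (x : S → (I → ℕ) → ℝ) (s : S) {k : I → ℕ} (hk : k ≠ 0) :
    xval a x s k = x s k := by
  simp [xval, hk]

lemma xavail_eq {Kbar : S → Finset (I → ℕ)} (hmono : KbarMono Kbar) (hzero : KbarZero Kbar)
    (a : S → ℝ) (x : S → (I → ℕ) → ℝ) (i : I) :
    xavail Kbar a x i = ∑ s, ∑ k ∈ occupied Kbar s i, xval a x s (k - econf i) := by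
  unfold xavail
  refine Finset.sum_congr rfl fun s _ => ?_
  rw [← sum_shift hmono s i (xval a x s), Finset.sum_filter, Finset.sum_filter,
    ← Finset.add_sum_erase _ _ (hzero s)]
  have he : econf i ≠ 0 := ne_zero_of_one_le (i := i) (by simp [econf])
  congr 1
  · simp [mem_Kc, he, xval_zero]
  · refine Finset.sum_congr rfl fun k hk => ?_
    rw [xval_of_ne a x s (Finset.ne_of_mem_erase hk)]

lemma sum_occupied {Kbar : S → Finset (I → ℕ)} (x : S → (I → ℕ) → ℝ) (s : S) (i : I) :
    ∑ k ∈ occupied Kbar s i, (k i : ℝ) * x s k = ∑ k ∈ Kc Kbar s, (k i : ℝ) * x s k := by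
  refine Finset.sum_subset (fun k hk => mem_Kc_of_mem_occupied hk) fun k hk hk' => ?_
  have : k i = 0 := by
    by_contra h
    exact hk' (mem_occupied.2 ⟨(mem_Kc.1 hk).2, Nat.one_le_iff_ne_zero.2 h⟩)
  simp [this]

/-- The net flow along the transition `k - e_i → k` at server type `s`. -/
def netFlow (Kbar : S → Finset (I → ℕ)) (a : S → ℝ) (μ ρ : I → ℝ)
    (x : S → (I → ℕ) → ℝ) (s : S) (k : I → ℕ) (i : I) : ℝ :=
  vrate Kbar a μ ρ x s k i - wrate μ x s k i

lemma sum_mul_Fdrift {Kbar : S → Finset (I → ℕ)} (hmono : KbarMono Kbar)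
    (a : S → ℝ) (μ ρ : I → ℝ) (x : S → (I → ℕ) → ℝ) (s : S) (g : (I → ℕ) → ℝ) (hg : g 0 = 0) :
    ∑ k ∈ Kc Kbar s, g k * Fdrift Kbar a μ ρ x s k
      = ∑ i, ∑ k ∈ occupied Kbar s i, (g k - g (k - econf i)) * netFlow Kbar a μ ρ x s k i := by
  have h1 : ∑ k ∈ Kc Kbar s, g k * Fdrift Kbar a μ ρ x s k
      = ∑ k ∈ Kbar s, g k * Fdrift Kbar a μ ρ x s k :=
    Finset.sum_erase _ (by simp [hg])
  have h2 : ∀ k ∈ Kbar s, g k * Fdrift Kbar a μ ρ x s k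
      = ∑ i, ((if 1 ≤ k i then g k * netFlow Kbar a μ ρ x s k i else 0)
          - if k + econf i ∈ Kbar s then g k * netFlow Kbar a μ ρ x s (k + econf i) i else 0) := by
    intro k hk
    have hJ : ∀ k i, vrate Kbar a μ ρ x s k i - wrate μ x s k i = netFlow Kbar a μ ρ x s k i :=
      fun _ _ => rfl
    simp only [Fdrift, hJ, Finset.sum_filter, Finset.sum_sub_distrib, mul_sub, Finset.mul_sum,
      sub_econf_mem hmono hk, and_true, mul_ite, mul_zero]
  rw [h1, Finset.sum_congr rfl h2, Finset.sum_comm]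
  refine Finset.sum_congr rfl fun i _ => ?_
  rw [Finset.sum_sub_distrib, ← Finset.sum_filter, ← Finset.sum_filter,
    sum_shift hmono s i fun k => g k * netFlow Kbar a μ ρ x s (k + econf i) i]
  change ∑ k ∈ occupied Kbar s i, _ - _ = _
  rw [← Finset.sum_sub_distrib]
  refine Finset.sum_congr rfl fun k hk => ?_
  rw [tsub_add_cancel_of_le (econf_le (mem_occupied.1 hk).2), sub_mul]

lemma xval_nonneg {Kbar : S → Finset (I → ℕ)} {a : S → ℝ} (hapos : ∀ s, 0 < a s)
    {x : S → (I → ℕ) → ℝ} (hx : x ∈ orthK Kbar) (s : S) (k : I → ℕ) : 0 ≤ xval a x s k := by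
  unfold xval
  split_ifs
  exacts [(hapos s).le, hx.1 s k]

lemma xavail_pos {Kbar : S → Finset (I → ℕ)} (hserve : KbarServe Kbar) {a : S → ℝ}
    (hapos : ∀ s, 0 < a s) {x : S → (I → ℕ) → ℝ} (hx : x ∈ orthK Kbar) (i : I) :
    0 < xavail Kbar a x i := by
  obtain ⟨s, hs⟩ := hserve i
  have he : econf i ∈ Kc Kbar s :=
    mem_Kc.2 ⟨ne_zero_of_one_le (i := i) (by simp [econf]), hs⟩
  refine Finset.sum_pos' (fun s' _ => ?_) ⟨s, Finset.mem_univ s, ?_⟩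
  · refine add_nonneg ?_ (Finset.sum_nonneg fun k _ => hx.1 s' k)
    split_ifs
    exacts [(hapos s').le, le_rfl]
  · rw [if_pos he]
    exact add_pos_of_pos_of_nonneg (hapos s) (Finset.sum_nonneg fun k _ => hx.1 s k)

lemma xval_le_xavail {Kbar : S → Finset (I → ℕ)} (hmono : KbarMono Kbar) (hzero : KbarZero Kbar)
    {a : S → ℝ} (hapos : ∀ s, 0 < a s) {x : S → (I → ℕ) → ℝ} (hx : x ∈ orthK Kbar)
    {s : S} {k : I → ℕ} {i : I} (hk : k ∈ occupied Kbar s i) :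
    xval a x s (k - econf i) ≤ xavail Kbar a x i := by
  rw [xavail_eq hmono hzero]
  have hnn := xval_nonneg hapos hx
  calc xval a x s (k - econf i)
      ≤ ∑ k ∈ occupied Kbar s i, xval a x s (k - econf i) :=
        Finset.single_le_sum (f := fun k => xval a x s (k - econf i)) (fun k _ => hnn s _) hk
    _ ≤ _ := Finset.single_le_sum
        (f := fun s => ∑ k ∈ occupied Kbar s i, xval a x s (k - econf i))
        (fun s _ => Finset.sum_nonneg fun k _ => hnn s _) (Finset.mem_univ s)

lemma mul_le_of_feasX {Kbar : S → Finset (I → ℕ)} {ρ : I → ℝ} {x : S → (I → ℕ) → ℝ}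
    (hx : x ∈ feasX Kbar ρ) {s : S} {k : I → ℕ} (hk : k ∈ Kc Kbar s) (i : I) :
    (k i : ℝ) * x s k ≤ ρ i := by
  rw [← hx.2 i]
  have hnn : ∀ s, ∀ k : I → ℕ, 0 ≤ (k i : ℝ) * x s k :=
    fun s k => mul_nonneg (Nat.cast_nonneg _) (hx.1.1 s k)
  calc (k i : ℝ) * x s k
      ≤ ∑ k ∈ Kc Kbar s, (k i : ℝ) * x s k :=
        Finset.single_le_sum (f := fun k : I → ℕ => (k i : ℝ) * x s k) (fun k _ => hnn s k) hk
    _ ≤ _ := Finset.single_le_sum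
        (f := fun s => ∑ k ∈ Kc Kbar s, (k i : ℝ) * x s k)
        (fun s _ => Finset.sum_nonneg fun k _ => hnn s k) (Finset.mem_univ s)

lemma sum_netFlow_eq_zero {Kbar : S → Finset (I → ℕ)} (hmono : KbarMono Kbar)
    (hzero : KbarZero Kbar) (hserve : KbarServe Kbar) {a : S → ℝ} (hapos : ∀ s, 0 < a s)
    (μ : I → ℝ) {ρ : I → ℝ} {x : S → (I → ℕ) → ℝ} (hx : x ∈ feasX Kbar ρ) (i : I) :
    ∑ s, ∑ k ∈ occupied Kbar s i, netFlow Kbar a μ ρ x s k i = 0 := by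
  have hpos := xavail_pos hserve hapos hx.1 i
  have hv : ∑ s, ∑ k ∈ occupied Kbar s i, vrate Kbar a μ ρ x s k i = μ i * ρ i := by
    simp only [vrate, ← Finset.mul_sum, ← Finset.sum_div]
    rw [← xavail_eq hmono hzero, mul_div_cancel_right₀ _ hpos.ne']
  have hw : ∑ s, ∑ k ∈ occupied Kbar s i, wrate μ x s k i = μ i * ρ i := by
    simp only [wrate, mul_comm _ (μ i), mul_assoc, ← Finset.mul_sum, sum_occupied]
    rw [hx.2 i]
  simp only [netFlow, Finset.sum_sub_distrib, hv, hw, sub_self]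

lemma ck_pos (k : I → ℕ) : 0 < ck k :=
  Finset.prod_pos fun i _ => by exact_mod_cast Nat.factorial_pos _

lemma ck_sub_econf {k : I → ℕ} {i : I} (hk : 1 ≤ k i) : ck k = k i * ck (k - econf i) := by
  unfold ck
  rw [← Finset.mul_prod_erase _ _ (Finset.mem_univ i), ← Finset.mul_prod_erase _
    (fun j => (((k - econf i) j).factorial : ℝ)) (Finset.mem_univ i), ← mul_assoc]
  congr 1
  · have : (k - econf i) i = k i - 1 := by simp [econf]
    rw [this]
    exact_mod_cast (Nat.mul_factorial_pred (by omega)).symm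
  · refine Finset.prod_congr rfl fun j hj => ?_
    simp [econf, Finset.ne_of_mem_erase hj]

/-- The partial derivative of `Lfun` in the direction `(k; s)`. -/
def potential (a : S → ℝ) (x : S → (I → ℕ) → ℝ) (s : S) (k : I → ℕ) : ℝ :=
  Real.log (xval a x s k * ck k / a s)

lemma potential_zero {a : S → ℝ} (hapos : ∀ s, 0 < a s) (x : S → (I → ℕ) → ℝ) (s : S) :
    potential a x s 0 = 0 := by
  simp [potential, xval_zero, ck, (hapos s).ne']

lemma xval_pos {Kbar : S → Finset (I → ℕ)} {a : S → ℝ} (hapos : ∀ s, 0 < a s)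
    {x : S → (I → ℕ) → ℝ} (hx : ∀ s, ∀ k ∈ Kc Kbar s, 0 < x s k) {s : S} {k : I → ℕ}
    (hk : k ∈ Kbar s) : 0 < xval a x s k := by
  rcases eq_or_ne k 0 with rfl | h
  · simpa [xval_zero] using hapos s
  · rw [xval_of_ne a x s h]
    exact hx s k (mem_Kc.2 ⟨h, hk⟩)

/-- The potential difference along a transition is, up to a constant depending only on the
customer type, the logarithmic ratio of the departure and arrival rates. -/
lemma potential_sub {Kbar : S → Finset (I → ℕ)} (hmono : KbarMono Kbar)
    (hserve : KbarServe Kbar) {ρ : I → ℝ} (hρpos : ∀ i, 0 < ρ i)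
    {a : S → ℝ} (hapos : ∀ s, 0 < a s) {μ : I → ℝ} (hμpos : ∀ i, 0 < μ i)
    {x : S → (I → ℕ) → ℝ} (hx : x ∈ orthK Kbar) (hpos : ∀ s, ∀ k ∈ Kc Kbar s, 0 < x s k)
    {s : S} {k : I → ℕ} {i : I} (hk : k ∈ occupied Kbar s i) :
    potential a x s k - potential a x s (k - econf i)
      = Real.log (ρ i / xavail Kbar a x i)
        - (Real.log (vrate Kbar a μ ρ x s k i) - Real.log (wrate μ x s k i)) := by
  obtain ⟨hk1, hk2⟩ := mem_occupied.1 hk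
  have hki : (0 : ℝ) < k i := by exact_mod_cast hk2
  have hx1 := hpos s k (mem_Kc_of_mem_occupied hk)
  have hx2 := xval_pos hapos hpos (sub_econf_mem hmono hk1 i)
  have hav := xavail_pos hserve hapos hx i
  have hc := ck_pos (k - econf i)
  have ha := hapos s
  have hμ := hμpos i
  have hρ := hρpos i
  unfold potential vrate wrate
  rw [xval_of_ne a x s (ne_zero_of_one_le hk2), ck_sub_econf hk2,
    Real.log_div (by positivity) (by positivity), Real.log_mul (by positivity) (by positivity),
    Real.log_mul (by positivity) (by positivity), Real.log_div (by positivity) (by positivity),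
    Real.log_mul (by positivity) (by positivity), Real.log_div (by positivity) (by positivity),
    Real.log_div (by positivity) (by positivity), Real.log_mul (by positivity) (by positivity),
    Real.log_mul (by positivity) (by positivity), Real.log_mul (by positivity) (by positivity),
    Real.log_mul (by positivity) (by positivity)]
  ring

lemma sq_div_le_log_sub_mul_sub {v w B : ℝ} (hv : 0 < v) (hw : 0 < w) (hvB : v ≤ B)
    (hwB : w ≤ B) : (v - w) ^ 2 / B ≤ (Real.log v - Real.log w) * (v - w) := by
  wlog h : w ≤ v generalizing v w
  · have := this hw hv hwB hvB (le_of_not_ge h)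
    calc (v - w) ^ 2 / B = (w - v) ^ 2 / B := by ring
      _ ≤ _ := this
      _ = _ := by ring
  have hlog : (v - w) / v ≤ Real.log v - Real.log w := by
    have := Real.one_sub_inv_le_log_of_pos (div_pos hv hw)
    rw [Real.log_div hv.ne' hw.ne', inv_div] at this
    rwa [sub_div, div_self hv.ne']
  calc (v - w) ^ 2 / B ≤ (v - w) ^ 2 / v := by gcongr
    _ = (v - w) / v * (v - w) := by ring
    _ ≤ _ := mul_le_mul_of_nonneg_right hlog (sub_nonneg.2 h)

/-- A lower bound for the rate at which `Lfun` decreases along fluid solutions. -/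
def dissipation (Kbar : S → Finset (I → ℕ)) (a : S → ℝ) (μ ρ : I → ℝ)
    (x : S → (I → ℕ) → ℝ) : ℝ :=
  ∑ s, ∑ i, ∑ k ∈ occupied Kbar s i, netFlow Kbar a μ ρ x s k i ^ 2 / (μ i * ρ i)

lemma sum_potential_mul_Fdrift_le {Kbar : S → Finset (I → ℕ)} (hmono : KbarMono Kbar)
    (hzero : KbarZero Kbar) (hserve : KbarServe Kbar) {ρ : I → ℝ} (hρpos : ∀ i, 0 < ρ i)
    {a : S → ℝ} (hapos : ∀ s, 0 < a s) {μ : I → ℝ} (hμpos : ∀ i, 0 < μ i)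
    {x : S → (I → ℕ) → ℝ} (hx : x ∈ feasX Kbar ρ) (hpos : ∀ s, ∀ k ∈ Kc Kbar s, 0 < x s k) :
    ∑ s, ∑ k ∈ Kc Kbar s, potential a x s k * Fdrift Kbar a μ ρ x s k
      ≤ -dissipation Kbar a μ ρ x := by
  have hbalance : ∑ s, ∑ i, ∑ k ∈ occupied Kbar s i,
      Real.log (ρ i / xavail Kbar a x i) * netFlow Kbar a μ ρ x s k i = 0 := by
    rw [Finset.sum_comm]
    simp only [← Finset.mul_sum, sum_netFlow_eq_zero hmono hzero hserve hapos μ hx, mul_zero,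
      Finset.sum_const_zero]
  calc ∑ s, ∑ k ∈ Kc Kbar s, potential a x s k * Fdrift Kbar a μ ρ x s k
      = ∑ s, ∑ i, ∑ k ∈ occupied Kbar s i,
          (potential a x s k - potential a x s (k - econf i)) * netFlow Kbar a μ ρ x s k i :=
        Finset.sum_congr rfl fun s _ =>
          sum_mul_Fdrift hmono a μ ρ x s (potential a x s) (potential_zero hapos x s)
    _ ≤ ∑ s, ∑ i, ∑ k ∈ occupied Kbar s i,
          (Real.log (ρ i / xavail Kbar a x i) * netFlow Kbar a μ ρ x s k i
            - netFlow Kbar a μ ρ x s k i ^ 2 / (μ i * ρ i)) := by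
        refine Finset.sum_le_sum fun s _ => Finset.sum_le_sum fun i _ =>
          Finset.sum_le_sum fun k hk => ?_
        have hk1 := (mem_occupied.1 hk).1
        have hki : (0 : ℝ) < k i := by exact_mod_cast (mem_occupied.1 hk).2
        have hx1 := hpos s k (mem_Kc_of_mem_occupied hk)
        have hx2 := xval_pos hapos hpos (sub_econf_mem hmono hk1 i)
        have hav := xavail_pos hserve hapos hx.1 i
        have hμ := hμpos i
        have hρ := hρpos i
        have hv : vrate Kbar a μ ρ x s k i ≤ μ i * ρ i := by
          unfold vrate
          rw [mul_div_assoc]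
          refine mul_le_of_le_one_right (by positivity) ((div_le_one hav).2 ?_)
          exact xval_le_xavail hmono hzero hapos hx.1 hk
        have hw : wrate μ x s k i ≤ μ i * ρ i := by
          have := mul_le_of_feasX hx (mem_Kc_of_mem_occupied hk) i
          calc wrate μ x s k i = μ i * (k i * x s k) := by unfold wrate; ring
            _ ≤ _ := mul_le_mul_of_nonneg_left this hμ.le
        have hv0 : 0 < vrate Kbar a μ ρ x s k i := by unfold vrate; positivity
        have hw0 : 0 < wrate μ x s k i := by unfold wrate; positivity
        have := sq_div_le_log_sub_mul_sub hv0 hw0 hv hw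
        rw [potential_sub hmono hserve hρpos hapos hμpos hx.1 hpos hk, sub_mul]
        exact sub_le_sub_left this _
    _ = -dissipation Kbar a μ ρ x := by
        simp only [Finset.sum_sub_distrib, hbalance, dissipation, zero_sub]

lemma mul_log_mul_div_exp {a c : ℝ} (ha : 0 < a) (hc : 0 < c) (u : ℝ) :
    u * Real.log (u * c / (Real.exp 1 * a)) = u * Real.log u + u * (Real.log (c / a) - 1) := by
  rcases eq_or_ne u 0 with rfl | hu
  · simp
  · have : u * c / (Real.exp 1 * a) = u * ((c / a) / Real.exp 1) := by field_simp
    rw [this, Real.log_mul hu (by positivity), Real.log_div (by positivity) (by positivity),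
      Real.log_exp]
    ring

lemma Lfun_eq {a : S → ℝ} (hapos : ∀ s, 0 < a s) (Kbar : S → Finset (I → ℕ))
    (x : S → (I → ℕ) → ℝ) :
    Lfun Kbar a x = ∑ s, ∑ k ∈ Kc Kbar s,
      (x s k * Real.log (x s k) + x s k * (Real.log (ck k / a s) - 1)) :=
  Finset.sum_congr rfl fun s _ => Finset.sum_congr rfl fun k _ =>
    mul_log_mul_div_exp (hapos s) (ck_pos k) _

lemma continuous_Lfun {a : S → ℝ} (hapos : ∀ s, 0 < a s) (Kbar : S → Finset (I → ℕ)) :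
    Continuous (Lfun Kbar a) := by
  have : Lfun Kbar a = _ := funext (Lfun_eq hapos Kbar)
  rw [this]
  have h : ∀ s k, Continuous fun x : S → (I → ℕ) → ℝ => x s k := fun s k => by fun_prop
  exact continuous_finsetSum _ fun s _ => continuous_finsetSum _ fun k _ =>
    (Real.continuous_mul_log.comp (h s k)).add ((h s k).mul continuous_const)

lemma continuous_distK (Kbar : S → Finset (I → ℕ)) (y : S → (I → ℕ) → ℝ) :
    Continuous fun x => distK Kbar x y := by
  unfold distK
  fun_prop

lemma isCompact_feasX (Kbar : S → Finset (I → ℕ)) (ρ : I → ℝ) : IsCompact (feasX Kbar ρ) := by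
  have hsub : feasX Kbar ρ ⊆ Set.univ.pi fun _ : S => Set.univ.pi fun _ : I → ℕ =>
      Set.Icc (0 : ℝ) (∑ i, |ρ i|) := by
    intro x hx s _ k _
    refine ⟨hx.1.1 s k, ?_⟩
    by_cases hk : k ∈ Kc Kbar s
    · obtain ⟨i, hi⟩ := exists_one_le (mem_Kc.1 hk).1
      calc x s k ≤ k i * x s k :=
            le_mul_of_one_le_left (hx.1.1 s k) (by exact_mod_cast hi)
        _ ≤ ρ i := mul_le_of_feasX hx hk i
        _ ≤ |ρ i| := le_abs_self _
        _ ≤ _ := Finset.single_le_sum (f := fun i => |ρ i|) (fun i _ => abs_nonneg _)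
            (Finset.mem_univ i)
    · rw [hx.1.2 s k hk]
      positivity
  refine IsCompact.of_isClosed_subset
    (isCompact_univ_pi fun _ => isCompact_univ_pi fun _ => isCompact_Icc) ?_ hsub
  have hset : feasX Kbar ρ = ((⋂ s, ⋂ k, {x | 0 ≤ x s k}) ∩
      ⋂ s, ⋂ k, ⋂ (_ : k ∉ Kc Kbar s), {x | x s k = 0}) ∩
      ⋂ i, {x | ∑ s, ∑ k ∈ Kc Kbar s, (k i : ℝ) * x s k = ρ i} := by
    ext x
    simp [feasX, orthK]
  rw [hset]
  refine ((isClosed_iInter fun s => isClosed_iInter fun k => ?_).inter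
    (isClosed_iInter fun s => isClosed_iInter fun k => isClosed_iInter fun _ => ?_)).inter
    (isClosed_iInter fun i => ?_)
  · exact isClosed_le (by fun_prop) (by fun_prop)
  · exact isClosed_eq (by fun_prop) (by fun_prop)
  · exact isClosed_eq (by fun_prop) (by fun_prop)

lemma continuousOn_dissipation {Kbar : S → Finset (I → ℕ)} (hserve : KbarServe Kbar)
    {a : S → ℝ} (hapos : ∀ s, 0 < a s) (μ ρ : I → ℝ) :
    ContinuousOn (dissipation Kbar a μ ρ) (feasX Kbar ρ) := by
  unfold dissipation netFlow vrate wrate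
  have hxval : ∀ s k, Continuous fun x : S → (I → ℕ) → ℝ => xval a x s k := by
    intro s k
    unfold xval
    split_ifs <;> fun_prop
  have hav : ∀ i, Continuous fun x : S → (I → ℕ) → ℝ => xavail Kbar a x i := by
    intro i
    unfold xavail
    fun_prop
  refine continuousOn_finsetSum _ fun s _ => continuousOn_finsetSum _ fun i _ =>
    continuousOn_finsetSum _ fun k _ => ContinuousOn.div_const (ContinuousOn.pow (ContinuousOn.sub
      (ContinuousOn.div ?_ (hav i).continuousOn fun x hx => (xavail_pos hserve hapos hx.1 i).ne')
      ?_) 2) _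
  · exact (continuous_const.mul (hxval s _)).continuousOn
  · fun_prop

lemma dissipation_nonneg (Kbar : S → Finset (I → ℕ)) (a : S → ℝ) {μ ρ : I → ℝ}
    (hρpos : ∀ i, 0 < ρ i) (hμpos : ∀ i, 0 < μ i) (x : S → (I → ℕ) → ℝ) :
    0 ≤ dissipation Kbar a μ ρ x :=
  Finset.sum_nonneg fun _ _ => Finset.sum_nonneg fun i _ => Finset.sum_nonneg fun _ _ =>
    div_nonneg (sq_nonneg _) (mul_pos (hμpos i) (hρpos i)).le

lemma netFlow_eq_zero_of_dissipation_eq_zero {Kbar : S → Finset (I → ℕ)} {a : S → ℝ}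
    {μ ρ : I → ℝ} (hρpos : ∀ i, 0 < ρ i) (hμpos : ∀ i, 0 < μ i) {x : S → (I → ℕ) → ℝ}
    (h : dissipation Kbar a μ ρ x = 0) {s : S} {i : I} {k : I → ℕ}
    (hk : k ∈ occupied Kbar s i) : netFlow Kbar a μ ρ x s k i = 0 := by
  have hB : ∀ i, 0 < μ i * ρ i := fun i => mul_pos (hμpos i) (hρpos i)
  have h0 : ∀ s i k, 0 ≤ netFlow Kbar a μ ρ x s k i ^ 2 / (μ i * ρ i) :=
    fun s i k => div_nonneg (sq_nonneg _) (hB i).le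
  have h1 := (Finset.sum_eq_zero_iff_of_nonneg fun s _ => Finset.sum_nonneg fun i _ =>
    Finset.sum_nonneg fun k _ => h0 s i k).1 h s (Finset.mem_univ s)
  have h2 := (Finset.sum_eq_zero_iff_of_nonneg fun i _ =>
    Finset.sum_nonneg fun k _ => h0 s i k).1 h1 i (Finset.mem_univ i)
  have h3 := (Finset.sum_eq_zero_iff_of_nonneg fun k _ => h0 s i k).1 h2 k hk
  simpa [(hB i).ne'] using h3

lemma prodForm_of_dissipation_eq_zero {Kbar : S → Finset (I → ℕ)} (hmono : KbarMono Kbar)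
    (hserve : KbarServe Kbar) {ρ : I → ℝ} (hρpos : ∀ i, 0 < ρ i) {a : S → ℝ}
    (hapos : ∀ s, 0 < a s) {μ : I → ℝ} (hμpos : ∀ i, 0 < μ i) {x : S → (I → ℕ) → ℝ}
    (hx : x ∈ orthK Kbar) (h : dissipation Kbar a μ ρ x = 0) :
    prodForm Kbar a x fun i => Real.log (ρ i / xavail Kbar a x i) := by
  set ν : I → ℝ := fun i => Real.log (ρ i / xavail Kbar a x i) with hν
  have key : ∀ n : ℕ, ∀ s, ∀ k ∈ Kbar s, ∑ i, k i = n →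
      xval a x s k = a s / ck k * Real.exp (∑ i, (k i : ℝ) * ν i) := by
    intro n
    induction n with
    | zero =>
      intro s k _ hn
      have : k = 0 := funext fun i => by simpa using Finset.sum_eq_zero_iff.1 hn i
      subst this
      simp [xval_zero, ck]
    | succ n ih =>
      intro s k hk hn
      have hk0 : k ≠ 0 := by rintro rfl; simp at hn
      obtain ⟨i, hi⟩ := exists_one_le hk0
      have hki : (0 : ℝ) < k i := by exact_mod_cast hi
      have hav := xavail_pos hserve hapos hx i
      have hμ := hμpos i
      have hρ := hρpos i
      have hc := ck_pos (k - econf i)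
      have hsplit : k = (k - econf i) + econf i := (tsub_add_cancel_of_le (econf_le hi)).symm
      have hflow := netFlow_eq_zero_of_dissipation_eq_zero hρpos hμpos h
        (mem_occupied.2 ⟨hk, hi⟩)
      have hn' : ∑ j, (k - econf i) j = n := by
        rw [hsplit] at hn
        simp only [Pi.add_apply, Finset.sum_add_distrib] at hn
        simpa [econf] using hn
      have hsum : ∑ j, (k j : ℝ) * ν j = ∑ j, ((k - econf i) j : ℝ) * ν j + ν i := by
        conv_lhs => rw [hsplit]
        simp [econf, add_mul, Finset.sum_add_distrib, Pi.single_apply]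
      have hexp : Real.exp (ν i) = ρ i / xavail Kbar a x i := Real.exp_log (by positivity)
      rw [netFlow, vrate, wrate, ih s _ (sub_econf_mem hmono hk i) hn', sub_eq_zero] at hflow
      rw [xval_of_ne a x s hk0, hsum, Real.exp_add, hexp, ck_sub_econf hi]
      field_simp at hflow ⊢
      linarith
  intro s k hk
  rw [← key _ s k (mem_Kc.1 hk).2 rfl, xval_of_ne a x s (mem_Kc.1 hk).1]

lemma Lfun_le_of_prodForm {Kbar : S → Finset (I → ℕ)} {ρ : I → ℝ} {a : S → ℝ}
    (hapos : ∀ s, 0 < a s) {p y : S → (I → ℕ) → ℝ} {ν : I → ℝ} (hp : p ∈ feasX Kbar ρ)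
    (hprod : prodForm Kbar a p ν) (hy : y ∈ feasX Kbar ρ) : Lfun Kbar a p ≤ Lfun Kbar a y := by
  have hlin : ∀ z ∈ feasX Kbar ρ,
      ∑ s, ∑ k ∈ Kc Kbar s, z s k * ∑ i, (k i : ℝ) * ν i = ∑ i, ρ i * ν i := by
    intro z hz
    calc ∑ s, ∑ k ∈ Kc Kbar s, z s k * ∑ i, (k i : ℝ) * ν i
        = ∑ s, ∑ k ∈ Kc Kbar s, ∑ i, ((k i : ℝ) * z s k) * ν i := by
          simp only [Finset.mul_sum]
          refine Finset.sum_congr rfl fun s _ => Finset.sum_congr rfl fun k _ =>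
            Finset.sum_congr rfl fun i _ => by ring
      _ = ∑ i, (∑ s, ∑ k ∈ Kc Kbar s, (k i : ℝ) * z s k) * ν i := by
          simp only [Finset.sum_mul]
          rw [Finset.sum_comm]
          exact Finset.sum_congr rfl fun s _ => Finset.sum_comm
      _ = _ := by simp only [hz.2]
  have hpterm : ∀ s, ∀ k ∈ Kc Kbar s,
      0 < p s k ∧ Real.log (p s k) = ∑ i, (k i : ℝ) * ν i - Real.log (ck k / a s) := by
    intro s k hk
    have ha := hapos s
    have hc := ck_pos k
    rw [hprod s k hk, Real.log_mul (by positivity) (by positivity), Real.log_exp,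
      ← inv_div, Real.log_inv]
    exact ⟨by positivity, by ring⟩
  have hcomp : ∑ s, ∑ k ∈ Kc Kbar s,
      ((p s k * Real.log (p s k) + p s k * (Real.log (ck k / a s) - 1))
        - p s k * ∑ i, (k i : ℝ) * ν i)
      ≤ ∑ s, ∑ k ∈ Kc Kbar s,
      ((y s k * Real.log (y s k) + y s k * (Real.log (ck k / a s) - 1))
        - y s k * ∑ i, (k i : ℝ) * ν i) := by
    refine Finset.sum_le_sum fun s _ => Finset.sum_le_sum fun k hk => ?_
    obtain ⟨hp0, hlog⟩ := hpterm s k hk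
    have hsum : ∑ i, (k i : ℝ) * ν i = Real.log (p s k) + Real.log (ck k / a s) := by
      rw [hlog]; ring
    rw [hsum]
    rcases (hy.1.1 s k).eq_or_lt with h0 | h0
    · rw [← h0]
      nlinarith
    · have := Real.log_le_sub_one_of_pos (div_pos hp0 h0)
      rw [Real.log_div hp0.ne' h0.ne', le_sub_iff_add_le, le_div_iff₀ h0] at this
      nlinarith
  rw [Lfun_eq hapos, Lfun_eq hapos]
  simpa only [Finset.sum_sub_distrib, hlin p hp, hlin y hy, sub_le_sub_iff_right] using hcomp

/-- Strict convexity of `Lfun` makes its minimizer over the feasible set unique. -/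
lemma eq_of_Lfun_le {Kbar : S → Finset (I → ℕ)} {ρ : I → ℝ} {a : S → ℝ}
    (hapos : ∀ s, 0 < a s) {x y : S → (I → ℕ) → ℝ} (hx : x ∈ feasX Kbar ρ)
    (hmin : ∀ z ∈ feasX Kbar ρ, Lfun Kbar a x ≤ Lfun Kbar a z) (hy : y ∈ feasX Kbar ρ)
    (hle : Lfun Kbar a y ≤ Lfun Kbar a x) : y = x := by
  by_contra hne
  obtain ⟨s₀, k₀, hk₀⟩ : ∃ s k, y s k ≠ x s k := by
    by_contra! h
    exact hne (funext fun s => funext fun k => h s k)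
  have hmem : k₀ ∈ Kc Kbar s₀ := by
    by_contra h
    exact hk₀ (by rw [hx.1.2 s₀ k₀ h, hy.1.2 s₀ k₀ h])
  set z : S → (I → ℕ) → ℝ := fun s k => (1 / 2) * y s k + (1 / 2) * x s k with hz
  have hzX : z ∈ feasX Kbar ρ := by
    refine ⟨⟨fun s k => ?_, fun s k hk => ?_⟩, fun i => ?_⟩
    · have := hx.1.1 s k
      have := hy.1.1 s k
      positivity
    · simp [hz, hx.1.2 s k hk, hy.1.2 s k hk]
    · simp only [hz, mul_add, mul_left_comm _ (1 / 2 : ℝ), Finset.sum_add_distrib,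
        ← Finset.mul_sum, hx.2 i, hy.2 i]
      ring
  have hterm : ∀ s k, z s k * Real.log (z s k) + z s k * (Real.log (ck k / a s) - 1)
      ≤ (1 / 2) * (y s k * Real.log (y s k) + y s k * (Real.log (ck k / a s) - 1))
        + (1 / 2) * (x s k * Real.log (x s k) + x s k * (Real.log (ck k / a s) - 1)) := by
    intro s k
    have := Real.convexOn_mul_log.2 (hy.1.1 s k) (hx.1.1 s k)
      (by norm_num : (0 : ℝ) ≤ 1 / 2) (by norm_num : (0 : ℝ) ≤ 1 / 2) (by norm_num)
    simp only [smul_eq_mul] at this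
    simp only [hz]
    linarith
  have hstrict : Lfun Kbar a z < (1 / 2) * Lfun Kbar a y + (1 / 2) * Lfun Kbar a x := by
    simp only [Lfun_eq hapos, Finset.mul_sum, ← Finset.sum_add_distrib]
    refine Finset.sum_lt_sum (fun s _ => Finset.sum_le_sum fun k _ => hterm s k)
      ⟨s₀, Finset.mem_univ _, Finset.sum_lt_sum (fun k _ => hterm s₀ k) ⟨k₀, hmem, ?_⟩⟩
    have := Real.strictConvexOn_mul_log.2 (hy.1.1 s₀ k₀) (hx.1.1 s₀ k₀) hk₀
      (by norm_num : (0 : ℝ) < 1 / 2) (by norm_num : (0 : ℝ) < 1 / 2) (by norm_num)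
    simp only [smul_eq_mul] at this
    simp only [hz]
    linarith
  linarith [hmin z hzX]

/-- Along a fluid solution every coordinate is positive at positive times. -/
lemma fluid_pos {Kbar : S → Finset (I → ℕ)} (hmono : KbarMono Kbar) (hserve : KbarServe Kbar)
    {ρ : I → ℝ} (hρpos : ∀ i, 0 < ρ i) {a : S → ℝ} (hapos : ∀ s, 0 < a s) {μ : I → ℝ}
    (hμpos : ∀ i, 0 < μ i) {x : ℝ → S → (I → ℕ) → ℝ}
    (hx : ∀ t : ℝ, 0 ≤ t → x t ∈ feasX Kbar ρ)
    (hderiv : ∀ s, ∀ k ∈ Kc Kbar s, ∀ t : ℝ, 0 ≤ t →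
      HasDerivAt (fun τ => x τ s k) (Fdrift Kbar a μ ρ (x t) s k) t)
    {t : ℝ} (ht : 0 < t) (s : S) : ∀ k ∈ Kc Kbar s, 0 < x t s k := by
  have hxt := (hx t ht.le).1
  have hv0 : ∀ k i, 0 ≤ vrate Kbar a μ ρ (x t) s k i := fun k i =>
    div_nonneg (mul_nonneg (mul_pos (hμpos i) (hρpos i)).le (xval_nonneg hapos hxt s _))
      (xavail_pos hserve hapos hxt i).le
  suffices key : ∀ n : ℕ, ∀ k ∈ Kbar s, ∑ i, k i = n → 0 < xval a (x t) s k by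
    intro k hk
    rw [← xval_of_ne a (x t) s (mem_Kc.1 hk).1]
    exact key _ k (mem_Kc.1 hk).2 rfl
  intro n
  induction n with
  | zero =>
    intro k _ hn
    have : k = 0 := funext fun i => by simpa using Finset.sum_eq_zero_iff.1 hn i
    simpa [this, xval_zero] using hapos s
  | succ n ih =>
    intro k hk hn
    have hk0 : k ≠ 0 := by rintro rfl; simp at hn
    obtain ⟨i, hi⟩ := exists_one_le hk0
    have hprev : 0 < xval a (x t) s (k - econf i) := by
      refine ih _ (sub_econf_mem hmono hk i) ?_
      rw [← tsub_add_cancel_of_le (econf_le hi)] at hn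
      simp only [Pi.add_apply, Finset.sum_add_distrib] at hn
      simpa [econf] using hn
    rw [xval_of_ne a (x t) s hk0]
    refine lt_of_le_of_ne (hxt.1 s k) fun h0 => ?_
    have hloc : IsLocalMin (fun τ => x τ s k) t := by
      filter_upwards [lt_mem_nhds ht] with τ hτ
      rw [← h0]
      exact (hx τ hτ.le).1.1 s k
    have hF := hloc.hasDerivAt_eq_zero (hderiv s k (mem_Kc.2 ⟨hk0, hk⟩) t ht.le)
    have hin : 0 < ∑ i ∈ Finset.univ.filter (fun i : I => 1 ≤ k i ∧ k - econf i ∈ Kbar s),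
        (vrate Kbar a μ ρ (x t) s k i - wrate μ (x t) s k i) := by
      simp only [wrate, ← h0, mul_zero, sub_zero]
      refine Finset.sum_pos' (fun i _ => hv0 k i)
        ⟨i, by simp [hi, sub_econf_mem hmono hk i], ?_⟩
      exact div_pos (mul_pos (mul_pos (hμpos i) (hρpos i)) hprev) (xavail_pos hserve hapos hxt i)
    have hout : ∑ i ∈ Finset.univ.filter (fun i : I => k + econf i ∈ Kbar s),
        (vrate Kbar a μ ρ (x t) s (k + econf i) i - wrate μ (x t) s (k + econf i) i) ≤ 0 := by
      refine Finset.sum_nonpos fun i _ => ?_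
      have h1 : vrate Kbar a μ ρ (x t) s (k + econf i) i = 0 := by
        simp [vrate, xval_of_ne a (x t) s hk0, ← h0]
      have h2 : 0 ≤ wrate μ (x t) s (k + econf i) i :=
        mul_nonneg (mul_nonneg (Nat.cast_nonneg _) (hμpos i).le) (hxt.1 s _)
      linarith
    unfold Fdrift at hF
    linarith

lemma hasDerivAt_Lfun {Kbar : S → Finset (I → ℕ)} {a : S → ℝ} (hapos : ∀ s, 0 < a s)
    {x : ℝ → S → (I → ℕ) → ℝ} {x' : S → (I → ℕ) → ℝ} {t : ℝ}
    (hpos : ∀ s, ∀ k ∈ Kc Kbar s, 0 < x t s k)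
    (hderiv : ∀ s, ∀ k ∈ Kc Kbar s, HasDerivAt (fun τ => x τ s k) (x' s k) t) :
    HasDerivAt (fun τ => Lfun Kbar a (x τ))
      (∑ s, ∑ k ∈ Kc Kbar s, potential a (x t) s k * x' s k) t := by
  simp only [Lfun_eq hapos]
  refine HasDerivAt.fun_sum fun s _ => HasDerivAt.fun_sum fun k hk => ?_
  have h0 := hpos s k hk
  have hc := ck_pos k
  have ha := hapos s
  have h := hderiv s k hk
  have h1 := (Real.hasDerivAt_mul_log h0.ne').comp t h
  refine (h1.add (h.mul_const (Real.log (ck k / a s) - 1))).congr_deriv ?_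
  rw [potential, xval_of_ne _ _ _ (mem_Kc.1 hk).1, mul_div_assoc,
    Real.log_mul h0.ne' (by positivity)]
  ring

/-- Lemma 4 core: every fluid solution converges to `x^{*,a}`,
uniformly over all solutions. -/
theorem fluid_solutions_converge_uniformly_to_minimizer
    (Kbar : S → Finset (I → ℕ))
    (hmono : KbarMono Kbar) (hzero : KbarZero Kbar) (hserve : KbarServe Kbar)
    (ρ : I → ℝ) (hρpos : ∀ i, 0 < ρ i) (hρsum : ∑ i, ρ i = 1)
    (a : S → ℝ) (hapos : ∀ s, 0 < a s)
    (μ : I → ℝ) (hμpos : ∀ i, 0 < μ i)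
    (xstar : S → (I → ℕ) → ℝ) (hxstar : xstar ∈ feasX Kbar ρ)
    (hmin : ∀ y ∈ feasX Kbar ρ, Lfun Kbar a xstar ≤ Lfun Kbar a y) :
    ∀ ε > (0 : ℝ), ∃ T > (0 : ℝ), ∀ x : ℝ → S → (I → ℕ) → ℝ,
      (∀ t : ℝ, 0 ≤ t → x t ∈ feasX Kbar ρ) →
      (∀ s, ∀ k ∈ Kc Kbar s, ∀ t : ℝ, 0 ≤ t →
        HasDerivAt (fun τ => x τ s k) (Fdrift Kbar a μ ρ (x t) s k) t) →
      ∀ t : ℝ, T ≤ t → distK Kbar (x t) xstar ≤ ε := by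
  intro ε hε
  have hX := isCompact_feasX Kbar ρ
  have hL := continuous_Lfun hapos Kbar
  have hne : ∀ x ∈ feasX Kbar ρ, x ≠ xstar → Lfun Kbar a xstar < Lfun Kbar a x :=
    fun x hx hxne => lt_of_not_ge fun h => hxne (eq_of_Lfun_le hapos hxstar hmin hx h)
  obtain ⟨m, hm, hfar⟩ : ∃ m, Lfun Kbar a xstar < m ∧
      ∀ x ∈ feasX Kbar ρ ∩ {x | ε ≤ distK Kbar x xstar}, m ≤ Lfun Kbar a x := by
    refine (hX.inter_right (isClosed_le continuous_const
      (continuous_distK Kbar xstar))).exists_forall_le' hL.continuousOn fun x hx => ?_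
    refine hne x hx.1 fun h => ?_
    have : ε ≤ distK Kbar x xstar := hx.2
    rw [h] at this
    simp only [distK, sub_self, abs_zero, Finset.sum_const_zero] at this
    linarith
  obtain ⟨δ, hδ, hdiss⟩ : ∃ δ, 0 < δ ∧
      ∀ x ∈ feasX Kbar ρ ∩ {x | m ≤ Lfun Kbar a x}, δ ≤ dissipation Kbar a μ ρ x := by
    refine (hX.inter_right (isClosed_le continuous_const hL)).exists_forall_le'
      ((continuousOn_dissipation hserve hapos μ ρ).mono Set.inter_subset_left) fun x hx => ?_
    refine lt_of_le_of_ne (dissipation_nonneg Kbar a hρpos hμpos x) fun h => ?_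
    have hle := Lfun_le_of_prodForm hapos hx.1
      (prodForm_of_dissipation_eq_zero hmono hserve hρpos hapos hμpos hx.1.1 h.symm) hxstar
    have : m ≤ Lfun Kbar a x := hx.2
    linarith
  obtain ⟨M, hM⟩ := hX.bddAbove_image hL.continuousOn
  have hM' : ∀ x ∈ feasX Kbar ρ, Lfun Kbar a x ≤ M := fun x hx => hM ⟨x, hx, rfl⟩
  have hmM : 0 ≤ (M - Lfun Kbar a xstar) / δ := div_nonneg (by linarith [hM' _ hxstar]) hδ.le
  refine ⟨1 + (M - Lfun Kbar a xstar) / δ, by linarith, fun x hx hderiv t ht => ?_⟩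
  have hpos : ∀ τ, 0 < τ → ∀ s, ∀ k ∈ Kc Kbar s, 0 < x τ s k := fun τ hτ s =>
    fluid_pos hmono hserve hρpos hapos hμpos hx hderiv hτ s
  have hLderiv : ∀ τ, 0 < τ → ∃ d ≤ -dissipation Kbar a μ ρ (x τ),
      HasDerivAt (fun τ => Lfun Kbar a (x τ)) d τ := fun τ hτ =>
    ⟨_, sum_potential_mul_Fdrift_le hmono hzero hserve hρpos hapos hμpos (hx τ hτ.le) (hpos τ hτ),
      hasDerivAt_Lfun hapos (hpos τ hτ) fun s k hk => hderiv s k hk τ hτ.le⟩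
  have hanti : AntitoneOn (fun τ => Lfun Kbar a (x τ)) (Set.Ici 1) := by
    refine antitoneOn_of_deriv_nonpos (convex_Ici 1) (fun τ hτ => ?_) (fun τ hτ => ?_)
      fun τ hτ => ?_
    · obtain ⟨d, -, h⟩ := hLderiv τ (zero_lt_one.trans_le hτ)
      exact h.continuousAt.continuousWithinAt
    · obtain ⟨d, -, h⟩ := hLderiv τ (zero_lt_one.trans_le (interior_subset hτ))
      exact h.differentiableAt.differentiableWithinAt
    · obtain ⟨d, hd, h⟩ := hLderiv τ (zero_lt_one.trans_le (interior_subset hτ))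
      rw [h.deriv]
      linarith [dissipation_nonneg Kbar a hρpos hμpos (x τ)]
  have ht1 : 1 ≤ t := by linarith
  by_contra! hdist
  have hmt : m ≤ Lfun Kbar a (x t) := hfar _ ⟨hx t (by linarith), hdist.le⟩
  have hdrop : Lfun Kbar a (x t) - Lfun Kbar a (x 1) ≤ -δ * (t - 1) := by
    refine (convex_Icc 1 t).image_sub_le_mul_sub_of_deriv_le
      (f := fun τ => Lfun Kbar a (x τ)) (fun τ hτ => ?_) (fun τ hτ => ?_) (fun τ hτ => ?_)
      1 ⟨le_rfl, ht1⟩ t ⟨ht1, le_rfl⟩ ht1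
    · obtain ⟨d, -, h⟩ := hLderiv τ (zero_lt_one.trans_le hτ.1)
      exact h.continuousAt.continuousWithinAt
    · obtain ⟨d, -, h⟩ := hLderiv τ (zero_lt_one.trans_le (interior_subset hτ).1)
      exact h.differentiableAt.differentiableWithinAt
    · have hτ' := interior_subset hτ
      obtain ⟨d, hd, h⟩ := hLderiv τ (zero_lt_one.trans_le hτ'.1)
      rw [h.deriv]
      have : δ ≤ dissipation Kbar a μ ρ (x τ) :=
        hdiss _ ⟨hx τ (by linarith [hτ'.1]), hmt.trans (hanti hτ'.1 ht1 hτ'.2)⟩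
      linarith
  have hx1 := hM' _ (hx 1 zero_le_one)
  have : M - Lfun Kbar a xstar ≤ δ * (t - 1) := by
    rw [← div_le_iff₀' hδ]
    linarith
  linarith
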